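/- Let M = (m_{ij}) be a homogeneous, well-ordered 2×2 matrix of integers of degree d > 0. A general form F of degree d in C[x_0,x_1,x_2] is the determinant of a 2×2 matrix of forms whose degree matrix is M if and only if either m_{11} = 0, or m_{11} = d, or m_{21} ≥ 0. -/

import Mathlib

open MvPolynomial Matrix

/-- `f` is a form of degree `m : ℤ` -/
def IsFormOfDeg {k : ℕ} (f : MvPolynomial (Fin k) ℂ) (m : ℤ) : Prop :=
  if m < 0 then f = 0 else f.IsHomogeneous m.toNat

def HasDegMatrix {k a b : ℕ} (N : Matrix (Fin a) (Fin b) (MvPolynomial (Fin k) ℂ))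
    (M : Matrix (Fin a) (Fin b) ℤ) : Prop :=
  ∀ i j, IsFormOfDeg (N i j) (M i j)

def IsHomogMatrix {a b : ℕ} (M : Matrix (Fin a) (Fin b) ℤ) : Prop :=
  ∀ (i i' : Fin a) (j j' : Fin b), i < i' → j < j' →
    M i j + M i' j' = M i j' + M i' j

def WellOrderedMatrix {a b : ℕ} (M : Matrix (Fin a) (Fin b) ℤ) : Prop :=
  (∀ (i i' : Fin a) (j : Fin b), i ≤ i' → M i' j ≤ M i j) ∧
  (∀ (i : Fin a) (j j' : Fin b), j ≤ j' → M i j ≤ M i j')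

/-- A property `P` holds for a general form of degree `d` in `k` variables. -/
def GeneralForm (k : ℕ) (d : ℤ) (P : MvPolynomial (Fin k) ℂ → Prop) : Prop :=
  ∃ Φ : MvPolynomial ((Fin k) →₀ ℕ) ℂ,
    (∃ f : MvPolynomial (Fin k) ℂ, IsFormOfDeg f d ∧ eval f.coeff Φ ≠ 0) ∧
    ∀ f : MvPolynomial (Fin k) ℂ, IsFormOfDeg f d → eval f.coeff Φ ≠ 0 → P f

noncomputable def minorsIdeal {k n : ℕ} (A : Matrix (Fin n) (Fin (n+1)) (MvPolynomial (Fin k) ℂ)) :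
    Ideal (MvPolynomial (Fin k) ℂ) :=
  Ideal.span (Set.range fun j : Fin (n+1) => (A.submatrix id j.succAbove).det)

def IsZeroDimIdeal (I : Ideal (MvPolynomial (Fin 3) ℂ)) : Prop :=
  ringKrullDim (MvPolynomial (Fin 3) ℂ ⧸ I) = 1

noncomputable def hilbFn (I : Ideal (MvPolynomial (Fin 3) ℂ)) (t : ℕ) : ℕ :=
  Module.finrank ℂ (homogeneousSubmodule (Fin 3) ℂ t) -
    Module.finrank ℂ
      (Submodule.restrictScalars ℂ I ⊓ homogeneousSubmodule (Fin 3) ℂ t : Submodule ℂ _)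

noncomputable def hilbFnZ (I : Ideal (MvPolynomial (Fin 3) ℂ)) (t : ℤ) : ℕ :=
  if t < 0 then 0 else hilbFn I t.toNat

def Cond2 {n : ℕ} (M : Matrix (Fin n) (Fin n) ℤ) : Prop :=
  ∀ (t : ℕ) (_ : 1 ≤ t) (h2 : t < n),
    M ⟨t, h2⟩ ⟨t - 1, by omega⟩ < 0 →
      ((∑ i : Fin (n - t), M ⟨t + i.1, by have := i.2; omega⟩ ⟨t + i.1, by have := i.2; omega⟩) = 0
        ∨ (∑ i : Fin (n - t), M ⟨t + i.1, by have := i.2; omega⟩ ⟨t + i.1, by have := i.2; omega⟩)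
            = ∑ i, M i i)

lemma exists_open_subset_range_of_injective {σ P : Type*} [Finite σ] [Finite P]
    (g : σ → MvPolynomial P ℂ) (hg : Function.Injective (aeval (R := ℂ) g)) :
    ∃ Φ : MvPolynomial σ ℂ, Φ ≠ 0 ∧
      ∀ x : σ → ℂ, eval x Φ ≠ 0 → ∃ p : P → ℂ, ∀ i, eval p (g i) = x i := by
  let f : MvPolynomial σ ℂ →+* MvPolynomial P ℂ := (aeval (R := ℂ) g).toRingHom
  have hfC : f.comp (algebraMap ℂ _) = algebraMap ℂ _ := (aeval (R := ℂ) g).comp_algebraMap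
  have hft : f.FiniteType := by
    refine RingHom.FiniteType.of_comp_finiteType (f := algebraMap ℂ (MvPolynomial σ ℂ)) ?_
    rw [hfC]
    exact RingHom.finiteType_algebraMap.mpr inferInstance
  have hfp : f.FinitePresentation := (RingHom.FinitePresentation.of_finiteType).mp hft
  obtain ⟨S, hS⟩ := PrimeSpectrum.exists_constructibleSetData_iff.mpr
    (PrimeSpectrum.isConstructible_range_comap hfp)
  have hbot : (⊥ : PrimeSpectrum (MvPolynomial σ ℂ)) ∈ S.toSet := by
    rw [hS]
    refine ⟨⊥, PrimeSpectrum.ext ?_⟩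
    exact (RingHom.ker_eq_bot_iff_eq_zero f).mpr fun x hx => hg (hx.trans (map_zero f).symm)
  simp only [PrimeSpectrum.ConstructibleSetData.toSet, Set.mem_iUnion] at hbot
  obtain ⟨D, hD, hbD⟩ := hbot
  have hD0 : D.f ≠ 0 := by
    intro h
    exact hbD.2 (by simp [h])
  have hDg : ∀ i, D.g i = 0 := by
    intro i
    exact hbD.1 ⟨i, rfl⟩
  refine ⟨D.f, hD0, fun x hx => ?_⟩
  have hmem : pointToPoint x ∈ S.toSet := by
    simp only [PrimeSpectrum.ConstructibleSetData.toSet, Set.mem_iUnion]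
    refine ⟨D, hD, ?_, ?_⟩
    · rintro _ ⟨i, rfl⟩
      rw [hDg i]
      exact Submodule.zero_mem _
    · intro h
      have h2 : D.f ∈ (vanishingIdeal ℂ {x} : Ideal (MvPolynomial σ ℂ)) := h rfl
      rw [mem_vanishingIdeal_singleton_iff] at h2
      exact hx (by rwa [aeval_eq_eval] at h2)
  rw [hS] at hmem
  obtain ⟨q, hq⟩ := hmem
  obtain ⟨m, hm, hqm⟩ := Ideal.exists_le_maximal q.asIdeal q.2.ne_top
  obtain ⟨p, rfl⟩ := (isMaximal_iff_eq_vanishingIdeal_singleton).mp hm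
  refine ⟨p, fun i => ?_⟩
  have h1 : (X i - C (x i)) ∈ (vanishingIdeal ℂ {x} : Ideal (MvPolynomial σ ℂ)) := by
    rw [mem_vanishingIdeal_singleton_iff]; simp
  have h2 : (X i - C (x i)) ∈ (PrimeSpectrum.comap f q).asIdeal := by
    rw [hq]; exact h1
  have h3 := hqm h2
  rw [mem_vanishingIdeal_singleton_iff] at h3
  have hf : f (X i - C (x i)) = g i - C (x i) := by simp [f]
  rw [hf] at h3
  have h4 : eval p (g i) - x i = 0 := by rwa [aeval_eq_eval, map_sub, eval_C] at h3
  exact sub_eq_zero.mp h4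

lemma card_le_card_of_open_subset_range {σ P : Type} [Finite σ] [Finite P]
    (g : σ → MvPolynomial P ℂ) (Φ : MvPolynomial σ ℂ) (hΦ : Φ ≠ 0)
    (h : ∀ x : σ → ℂ, eval x Φ ≠ 0 → ∃ p : P → ℂ, ∀ i, eval p (g i) = x i) :
    Nat.card σ ≤ Nat.card P := by
  have hai : AlgebraicIndependent ℂ g := by
    rw [algebraicIndependent_iff]
    intro Ψ hΨ
    by_contra h0
    have hne := mul_ne_zero hΦ h0
    obtain ⟨x, hx⟩ : ∃ x, eval x (Φ * Ψ) ≠ 0 := by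
      by_contra! hh
      exact hne (funext fun x => by simpa using hh x)
    rw [map_mul] at hx
    obtain ⟨p, hp⟩ := h x (left_ne_zero_of_mul hx)
    apply right_ne_zero_of_mul hx
    have := congrArg (eval p) hΨ
    rw [map_zero, ← coe_aeval_eq_eval, RingHom.coe_coe, ← AlgHom.comp_apply, comp_aeval] at this
    rw [← this, ← coe_aeval_eq_eval, RingHom.coe_coe]
    congr 2
    ext i
    simp [← hp i]
  have := hai.cardinalMk_le_trdeg
  rw [MvPolynomial.trdeg_of_isDomain, Cardinal.lift_id] at this
  exact Cardinal.toNat_le_toNat this Cardinal.mk_lt_aleph0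

lemma aeval_injective_of_surjective_derivative {σ P : Type*} [Finite σ] [Finite P]
    (g : σ → MvPolynomial P ℂ) (β : (P → ℂ) →ₗ[ℂ] (P → ℂ) →ₗ[ℂ] (σ → ℂ))
    (hg : ∀ p i, eval p (g i) = β p p i) (p₀ : P → ℂ)
    (hs : ∀ y, ∃ q, β p₀ q + β q p₀ = y) :
    Function.Injective (aeval (R := ℂ) g) := by
  have := Fintype.ofFinite σ
  have := Fintype.ofFinite P
  rw [injective_iff_map_eq_zero]
  intro Ψ hΨ
  have hvan : ∀ p, eval (β p p) Ψ = 0 := by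
    intro p
    have h1 := congrArg (aeval (R := ℂ) p) hΨ
    rw [map_zero, ← AlgHom.comp_apply, comp_aeval, aeval_eq_eval] at h1
    rw [← h1]
    congr 2
    ext i
    rw [← hg p i, aeval_eq_eval]
  let B := β.toContinuousBilinearMap
  have hder : HasStrictFDerivAt (fun p => B p p)
      (B.precompR (P → ℂ) p₀ (.id ℂ _) + B.precompL (P → ℂ) (.id ℂ _) p₀) p₀ :=
    B.hasStrictFDerivAt_of_bilinear (hasStrictFDerivAt_id p₀) (hasStrictFDerivAt_id p₀)
  have hmap := hder.map_nhds_eq_of_surj (by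
    rw [LinearMap.range_eq_top]
    intro y
    obtain ⟨q, hq⟩ := hs y
    exact ⟨q, by simpa [B] using hq⟩)
  have hnhds : {y : σ → ℂ | eval y Ψ = 0} ∈ nhds (B p₀ p₀) := by
    rw [← hmap, Filter.mem_map]
    exact Filter.univ_mem' fun p => hvan p
  obtain ⟨ε, hε, hball⟩ := Metric.mem_nhds_iff.mp hnhds
  refine funext_set (fun i => Metric.ball (B p₀ p₀ i) ε) (fun i => ?_) (fun x hx => ?_)
  · exact infinite_of_mem_nhds _ (Metric.ball_mem_nhds _ hε)
  · rw [map_zero]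
    apply hball
    rw [ball_pi _ hε]
    exact hx

/-- Exponents of the monomials of degree `n` in three variables. -/
abbrev TernaryExponent (n : ℕ) : Type := {m : Fin 3 →₀ ℕ // m.degree = n}

instance (n : ℕ) : Finite (TernaryExponent n) := Finsupp.finite_of_degree_eq n

noncomputable instance (n : ℕ) : Fintype (TernaryExponent n) := Fintype.ofFinite _

/-- The ternary form of degree `n` with prescribed coefficients. -/
noncomputable def ternaryForm {R : Type*} [CommSemiring R] (n : ℕ) :
    (TernaryExponent n → R) →ₗ[R] MvPolynomial (Fin 3) R where
  toFun x := ∑ m, monomial m.1 (x m)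
  map_add' x y := by simp [Finset.sum_add_distrib]
  map_smul' r x := by simp [Finset.smul_sum, smul_monomial]

section ternaryForm

variable {R : Type*} [CommSemiring R] {n : ℕ}

lemma ternaryForm_apply (x : TernaryExponent n → R) :
    ternaryForm n x = ∑ m, monomial m.1 (x m) := rfl

lemma ternaryForm_isHomogeneous (x : TernaryExponent n → R) :
    (ternaryForm n x).IsHomogeneous n :=
  IsHomogeneous.sum _ _ _ fun m _ => isHomogeneous_monomial _ m.2

lemma coeff_ternaryForm (x : TernaryExponent n → R) (m : TernaryExponent n) :
    coeff m.1 (ternaryForm n x) = x m := by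
  classical
  simp [ternaryForm_apply, coeff_sum, coeff_monomial, Subtype.coe_inj]

lemma MvPolynomial.IsHomogeneous.coeff_eq_zero_of_degree_ne {f : MvPolynomial (Fin 3) R}
    (hf : f.IsHomogeneous n) {m : Fin 3 →₀ ℕ} (hm : m.degree ≠ n) : coeff m f = 0 := by
  by_contra h
  exact hm (by rw [Finsupp.degree_eq_weight_one]; exact hf h)

lemma MvPolynomial.IsHomogeneous.ext_coeff {f g : MvPolynomial (Fin 3) R}
    (hf : f.IsHomogeneous n) (hg : g.IsHomogeneous n)
    (h : ∀ m : TernaryExponent n, coeff m.1 f = coeff m.1 g) : f = g := by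
  ext m
  by_cases hm : m.degree = n
  · exact h ⟨m, hm⟩
  · rw [hf.coeff_eq_zero_of_degree_ne hm, hg.coeff_eq_zero_of_degree_ne hm]

lemma ternaryForm_coeff {f : MvPolynomial (Fin 3) R} (hf : f.IsHomogeneous n) :
    ternaryForm n (fun m => coeff m.1 f) = f :=
  (ternaryForm_isHomogeneous _).ext_coeff hf fun m => coeff_ternaryForm _ m

lemma map_ternaryForm {S : Type*} [CommSemiring S] (φ : R →+* S) (x : TernaryExponent n → R) :
    map φ (ternaryForm n x) = ternaryForm n (φ ∘ x) := by
  simp [ternaryForm_apply, map_monomial]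

end ternaryForm

/-- The bilinear map whose restriction to the diagonal is the determinant. -/
noncomputable def detBilin (a b c e d : ℕ) :
    (TernaryExponent a ⊕ TernaryExponent b ⊕ TernaryExponent c ⊕ TernaryExponent e → ℂ) →ₗ[ℂ]
    (TernaryExponent a ⊕ TernaryExponent b ⊕ TernaryExponent c ⊕ TernaryExponent e → ℂ) →ₗ[ℂ]
    (TernaryExponent d → ℂ) :=
  LinearMap.mk₂ ℂ (fun p q m => coeff m.1
      (ternaryForm a (fun i => p (.inl i)) * ternaryForm b (fun i => q (.inr (.inl i))) -
        ternaryForm c (fun i => p (.inr (.inr (.inl i)))) *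
          ternaryForm e (fun i => q (.inr (.inr (.inr i))))))
    (fun p p' q => by
      ext m
      simp only [Pi.add_apply, ← coeff_add]
      congr 1
      change ternaryForm a ((fun i => p (.inl i)) + fun i => p' (.inl i)) * _ -
        ternaryForm c ((fun i => p (.inr (.inr (.inl i)))) +
          fun i => p' (.inr (.inr (.inl i)))) * _ = _
      rw [map_add, map_add]
      ring)
    (fun r p q => by
      ext m
      simp only [Pi.smul_apply, ← coeff_smul]
      congr 1
      change ternaryForm a (r • fun i => p (.inl i)) * _ -
        ternaryForm c (r • fun i => p (.inr (.inr (.inl i)))) * _ = _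
      rw [map_smul, map_smul, smul_sub, smul_mul_assoc, smul_mul_assoc])
    (fun p q q' => by
      ext m
      simp only [Pi.add_apply, ← coeff_add]
      congr 1
      change _ * ternaryForm b ((fun i => q (.inr (.inl i))) + fun i => q' (.inr (.inl i))) -
        _ * ternaryForm e ((fun i => q (.inr (.inr (.inr i)))) +
          fun i => q' (.inr (.inr (.inr i)))) = _
      rw [map_add, map_add]
      ring)
    (fun r p q => by
      ext m
      simp only [Pi.smul_apply, ← coeff_smul]
      congr 1
      change _ * ternaryForm b (r • fun i => q (.inr (.inl i))) -
        _ * ternaryForm e (r • fun i => q (.inr (.inr (.inr i)))) = _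
      rw [map_smul, map_smul, smul_sub, mul_smul_comm, mul_smul_comm])

lemma exists_dominant_det {a b c e d : ℕ} (hab : a + b = d) (hce : c + e = d)
    {A B D E : MvPolynomial (Fin 3) ℂ} (hA : A.IsHomogeneous a) (hD : D.IsHomogeneous b)
    (hB : B.IsHomogeneous c) (hE : E.IsHomogeneous e)
    (hspan : ∀ F : MvPolynomial (Fin 3) ℂ, F.IsHomogeneous d →
      ∃ A' D' B' E' : MvPolynomial (Fin 3) ℂ, A'.IsHomogeneous a ∧ D'.IsHomogeneous b ∧
        B'.IsHomogeneous c ∧ E'.IsHomogeneous e ∧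
        F = A * D' + A' * D - (B * E' + B' * E)) :
    ∃ Φ : MvPolynomial (TernaryExponent d) ℂ, Φ ≠ 0 ∧
      ∀ F : MvPolynomial (Fin 3) ℂ, F.IsHomogeneous d → eval (fun m => coeff m.1 F) Φ ≠ 0 →
      ∃ A' D' B' E' : MvPolynomial (Fin 3) ℂ, A'.IsHomogeneous a ∧ D'.IsHomogeneous b ∧
        B'.IsHomogeneous c ∧ E'.IsHomogeneous e ∧ F = A' * D' - B' * E' := by
  let P := TernaryExponent a ⊕ TernaryExponent b ⊕ TernaryExponent c ⊕ TernaryExponent e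
  let g : TernaryExponent d → MvPolynomial P ℂ := fun m => coeff m.1
    (ternaryForm a (fun i => (X (.inl i) : MvPolynomial P ℂ)) *
        ternaryForm b (fun i => (X (.inr (.inl i)) : MvPolynomial P ℂ)) -
      ternaryForm c (fun i => (X (.inr (.inr (.inl i))) : MvPolynomial P ℂ)) *
        ternaryForm e (fun i => (X (.inr (.inr (.inr i))) : MvPolynomial P ℂ)))
  have hg : ∀ p i, eval p (g i) = detBilin a b c e d p p i := by
    intro p i
    simp only [g, ← coeff_map, map_sub, map_mul, map_ternaryForm]
    simp [detBilin, Function.comp_def]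
  have hdet : ∀ p q i, detBilin a b c e d p q i = coeff i.1
      (ternaryForm a (fun i => p (.inl i)) * ternaryForm b (fun i => q (.inr (.inl i))) -
        ternaryForm c (fun i => p (.inr (.inr (.inl i)))) *
          ternaryForm e (fun i => q (.inr (.inr (.inr i))))) := fun _ _ _ => rfl
  have hinj := aeval_injective_of_surjective_derivative g (detBilin a b c e d) hg
    (Sum.elim (fun m => coeff m.1 A) (Sum.elim (fun m => coeff m.1 D)
      (Sum.elim (fun m => coeff m.1 B) (fun m => coeff m.1 E)))) (by
    intro y
    obtain ⟨A', D', B', E', hA', hD', hB', hE', hF⟩ :=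
      hspan (ternaryForm d y) (ternaryForm_isHomogeneous y)
    refine ⟨Sum.elim (fun m => coeff m.1 A') (Sum.elim (fun m => coeff m.1 D')
      (Sum.elim (fun m => coeff m.1 B') (fun m => coeff m.1 E'))), ?_⟩
    ext m
    rw [Pi.add_apply, hdet, hdet, ← coeff_add, ← coeff_ternaryForm y m, hF]
    simp only [Sum.elim_inl, Sum.elim_inr, ternaryForm_coeff hA, ternaryForm_coeff hD,
      ternaryForm_coeff hB, ternaryForm_coeff hE, ternaryForm_coeff hA', ternaryForm_coeff hD',
      ternaryForm_coeff hB', ternaryForm_coeff hE']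
    congr 1
    ring)
  obtain ⟨Φ, hΦ, h⟩ := exists_open_subset_range_of_injective g hinj
  refine ⟨Φ, hΦ, fun F hF hFΦ => ?_⟩
  obtain ⟨p, hp⟩ := h _ hFΦ
  refine ⟨_, _, _, _, ternaryForm_isHomogeneous (fun i => p (.inl i)),
    ternaryForm_isHomogeneous (fun i => p (.inr (.inl i))),
    ternaryForm_isHomogeneous (fun i => p (.inr (.inr (.inl i)))),
    ternaryForm_isHomogeneous (fun i => p (.inr (.inr (.inr i)))), ?_⟩
  have hsub := IsHomogeneous.sub
    (hab ▸ (ternaryForm_isHomogeneous (fun i => p (.inl i))).mul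
      (ternaryForm_isHomogeneous (fun i => p (.inr (.inl i)))))
    (hce ▸ (ternaryForm_isHomogeneous (fun i => p (.inr (.inr (.inl i))))).mul
      (ternaryForm_isHomogeneous (fun i => p (.inr (.inr (.inr i))))))
  exact hF.ext_coeff hsub fun m => by rw [← hp m, hg, hdet]

lemma exists_homogenization (h : MvPolynomial (Fin 2) ℂ) {n : ℕ} (hn : h.totalDegree ≤ n) :
    ∃ G : MvPolynomial (Fin 3) ℂ, G.IsHomogeneous n ∧ ∀ v : Fin 3 → ℂ, v 2 ≠ 0 →
      eval v G = v 2 ^ n * eval ![v 0 / v 2, v 1 / v 2] h := by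
  have hdeg : ∀ m ∈ h.support, m 0 + m 1 ≤ n := fun m hm => by
    have := (le_totalDegree hm).trans hn
    rwa [Finsupp.sum_fintype _ _ (fun _ => rfl), Fin.sum_univ_two] at this
  refine ⟨∑ m ∈ h.support, C (coeff m h) * (X 0 ^ m 0 * X 1 ^ m 1 * X 2 ^ (n - (m 0 + m 1))),
    IsHomogeneous.sum _ _ _ fun m hm => IsHomogeneous.C_mul ?_ _, fun v hv => ?_⟩
  · have := ((isHomogeneous_X_pow (R := ℂ) (0 : Fin 3) (m 0)).mul
      (isHomogeneous_X_pow 1 (m 1))).mul (isHomogeneous_X_pow 2 (n - (m 0 + m 1)))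
    rwa [Nat.add_sub_cancel' (hdeg m hm)] at this
  · rw [map_sum, eval_eq' _ h, Finset.mul_sum]
    refine Finset.sum_congr rfl fun m hm => ?_
    obtain ⟨k, hk⟩ := Nat.exists_eq_add_of_le (hdeg m hm)
    simp only [map_mul, eval_C, map_pow, eval_X, Fin.prod_univ_two, hk, Nat.add_sub_cancel_left,
      Matrix.cons_val_zero, Matrix.cons_val_one, div_pow, pow_add]
    field_simp

lemma MvPolynomial.IsHomogeneous.exists_dehomogenization {F : MvPolynomial (Fin 3) ℂ} {n : ℕ}
    (hF : F.IsHomogeneous n) :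
    ∃ f : MvPolynomial (Fin 2) ℂ, f.totalDegree ≤ n ∧ ∀ v : Fin 3 → ℂ, v 2 ≠ 0 →
      eval v F = v 2 ^ n * eval ![v 0 / v 2, v 1 / v 2] f := by
  have hdeg : ∀ m ∈ F.support, m 0 + m 1 + m 2 = n := fun m hm => by
    have : Finsupp.weight (fun _ => 1) m = n := hF (mem_support_iff.mp hm)
    rwa [← Finsupp.degree_eq_weight_one, Finsupp.degree_eq_sum, Fin.sum_univ_three] at this
  refine ⟨∑ m ∈ F.support, C (coeff m F) * (X 0 ^ m 0 * X 1 ^ m 1),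
    totalDegree_finsetSum_le fun m hm => ?_, fun v hv => ?_⟩
  · have h1 := totalDegree_mul (C (coeff m F)) (X 0 ^ m 0 * X 1 ^ m 1 : MvPolynomial (Fin 2) ℂ)
    have h2 := totalDegree_mul (X 0 ^ m 0) (X 1 ^ m 1 : MvPolynomial (Fin 2) ℂ)
    simp only [totalDegree_C, totalDegree_X_pow] at h1 h2
    have := hdeg m hm
    omega
  · rw [map_sum, eval_eq' _ F, Finset.mul_sum]
    refine Finset.sum_congr rfl fun m hm => ?_
    rw [← hdeg m hm]
    simp only [map_mul, eval_C, map_pow, eval_X, Fin.prod_univ_three,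
      Matrix.cons_val_zero, Matrix.cons_val_one, div_pow, pow_add]
    field_simp

lemma eq_of_forall_eval_eq_of_ne_zero {F G : MvPolynomial (Fin 3) ℂ}
    (h : ∀ v : Fin 3 → ℂ, v 2 ≠ 0 → eval v F = eval v G) : F = G := by
  refine mul_right_cancel₀ (X_ne_zero (2 : Fin 3)) (funext fun v => ?_)
  by_cases hv : v 2 = 0
  · simp [hv]
  · simp [h v hv]

/-- A form of degree `s.card` vanishing on the lines `ℓ = k * X 2` for `k ∈ s`. -/
noncomputable def lineProd (ℓ : MvPolynomial (Fin 3) ℂ) (s : Finset ℕ) : MvPolynomial (Fin 3) ℂ :=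
  ∏ k ∈ s, (ℓ - C (k : ℂ) * X 2)

lemma lineProd_isHomogeneous {ℓ : MvPolynomial (Fin 3) ℂ} (hℓ : ℓ.IsHomogeneous 1)
    (s : Finset ℕ) : (lineProd ℓ s).IsHomogeneous s.card := by
  have := IsHomogeneous.prod s (fun k => ℓ - C (k : ℂ) * X 2) (fun _ => 1)
    fun k _ => hℓ.sub ((isHomogeneous_X ℂ 2).C_mul _)
  rwa [Finset.sum_const, smul_eq_mul, mul_one] at this

lemma eval_lineProd (ℓ : MvPolynomial (Fin 3) ℂ) (s : Finset ℕ) (v : Fin 3 → ℂ) :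
    eval v (lineProd ℓ s) = ∏ k ∈ s, (eval v ℓ - k * v 2) := by
  simp [lineProd, map_prod]

lemma eval_lineProd_eq_zero_iff {ℓ : MvPolynomial (Fin 3) ℂ} {s : Finset ℕ} {v : Fin 3 → ℂ} {n : ℕ}
    (hv : v 2 = 1) (hn : eval v ℓ = n) : eval v (lineProd ℓ s) = 0 ↔ n ∈ s := by
  rw [eval_lineProd, Finset.prod_eq_zero_iff]
  simp only [hv, hn, mul_one, sub_eq_zero, Nat.cast_inj]
  simp

lemma X_sub_C_ne_zero_of_fin_two (i : Fin 2) (r : ℂ) :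
    (X i - C r : MvPolynomial (Fin 2) ℂ) ≠ 0 := fun h => by
  have := congrArg (eval fun _ => r + 1) h
  simp at this

lemma totalDegree_prod_X_sub_C (i : Fin 2) (s : Finset ℂ) :
    (∏ r ∈ s, (X i - C r : MvPolynomial (Fin 2) ℂ)).totalDegree = s.card := by
  classical
  have hdeg : ∀ r : ℂ, (X i - C r : MvPolynomial (Fin 2) ℂ).totalDegree = 1 := fun r => by
    rw [sub_eq_add_neg, ← C_neg, totalDegree_add_eq_left_of_totalDegree_lt (by simp),
      totalDegree_X]
  induction s using Finset.induction_on with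
  | empty => simp
  | insert r s hr ih =>
    rw [Finset.prod_insert hr, totalDegree_mul_of_isDomain (X_sub_C_ne_zero_of_fin_two i r)
      (Finset.prod_ne_zero_iff.mpr fun r _ => X_sub_C_ne_zero_of_fin_two i r), ih,
      Finset.card_insert_of_notMem hr, hdeg, add_comm]

lemma exists_eq_add_of_forall_eval_grid_eq_zero {a e d : ℕ} (ha : 0 < a) (he : 0 < e)
    (had : a ≤ d) (hed : e ≤ d) {F : MvPolynomial (Fin 3) ℂ} (hF : F.IsHomogeneous d)
    (hgrid : ∀ i < a, ∀ j < e, eval ![(i : ℂ), j, 1] F = 0) :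
    ∃ U V : MvPolynomial (Fin 3) ℂ, U.IsHomogeneous (d - a) ∧ V.IsHomogeneous (d - e) ∧
      F = lineProd (X 0) (Finset.range a) * U + lineProd (X 1) (Finset.range e) * V := by
  classical
  obtain ⟨f, hfd, hf⟩ := hF.exists_dehomogenization
  let T : ℕ → Finset ℂ := fun n => (Finset.range n).image (fun k : ℕ => (k : ℂ))
  have hT : ∀ n, (T n).card = n := fun n => by
    rw [Finset.card_image_of_injective _ Nat.cast_injective, Finset.card_range]
  have hTprod : ∀ n (i : Fin 2), ∏ r ∈ T n, (X i - C r : MvPolynomial (Fin 2) ℂ) =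
      ∏ k ∈ Finset.range n, (X i - C (k : ℂ)) := fun n i =>
    Finset.prod_image fun _ _ _ _ h => Nat.cast_injective h
  obtain ⟨h, hdeg, hfh⟩ := combinatorial_nullstellensatz_exists_linearCombination
    (![T a, T e]) (by
      intro i
      rw [← Finset.card_pos]
      fin_cases i
      · simpa [hT] using ha
      · simpa [hT] using he)
    f (by
      intro x hx
      obtain ⟨i, hi, hi'⟩ := Finset.mem_image.mp (hx 0)
      obtain ⟨j, hj, hj'⟩ := Finset.mem_image.mp (hx 1)
      have h1 := hf ![(i : ℂ), j, 1] (by simp)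
      rw [hgrid i (Finset.mem_range.mp hi) j (Finset.mem_range.mp hj)] at h1
      have h2 : x = ![(i : ℂ), j] := by
        ext k; fin_cases k
        · exact hi'.symm
        · exact hj'.symm
      rw [h2]
      simpa using h1.symm)
  have hle : ∀ (n : ℕ) (i : Fin 2) (g : MvPolynomial (Fin 2) ℂ),
      ((∏ s ∈ T n, (X i - C s)) * g).totalDegree ≤ f.totalDegree → g.totalDegree ≤ d - n := by
    intro n i g hg
    by_cases hg0 : g = 0
    · simp [hg0]
    · rw [totalDegree_mul_of_isDomain (Finset.prod_ne_zero_iff.mpr fun r _ =>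
        X_sub_C_ne_zero_of_fin_two i r) hg0, totalDegree_prod_X_sub_C, hT] at hg
      omega
  obtain ⟨U, hU, hUe⟩ := exists_homogenization (h 0) (hle a 0 (h 0) (hdeg 0))
  obtain ⟨V, hV, hVe⟩ := exists_homogenization (h 1) (hle e 1 (h 1) (hdeg 1))
  refine ⟨U, V, hU, hV, eq_of_forall_eval_eq_of_ne_zero fun v hv => ?_⟩
  have hlin : ∀ (n : ℕ) (i : Fin 3) (j : Fin 2) (y : Fin 2 → ℂ), y j = v i / v 2 → n ≤ d →
      v 2 ^ d * ∏ k ∈ Finset.range n, (y j - (k : ℂ)) =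
      eval v (lineProd (X i) (Finset.range n)) * v 2 ^ (d - n) := by
    intro n i j y hy hn
    have : ∀ k ∈ Finset.range n, eval v (X i) - k * v 2 = v 2 * (y j - k) := fun k _ => by
      rw [hy, eval_X]; field_simp
    rw [eval_lineProd, Finset.prod_congr rfl this, Finset.prod_mul_distrib, Finset.prod_const,
      Finset.card_range]
    nth_rewrite 1 [← Nat.add_sub_cancel' hn]
    ring
  rw [hf v hv, hfh, Finsupp.linearCombination_apply, Finsupp.sum_fintype _ _ (by simp),
    Fin.sum_univ_two]
  simp only [smul_eq_mul, Matrix.cons_val_zero, Matrix.cons_val_one, hTprod, map_add, map_mul,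
    map_prod, map_sub, eval_X, eval_C, hUe v hv, hVe v hv]
  have h0 := hlin a 0 0 ![v 0 / v 2, v 1 / v 2] rfl had
  have h1 := hlin e 1 1 ![v 0 / v 2, v 1 / v 2] rfl hed
  simp only [Matrix.cons_val_zero, Matrix.cons_val_one] at h0 h1
  linear_combination (eval ![v 0 / v 2, v 1 / v 2] (h 0)) * h0 +
    (eval ![v 0 / v 2, v 1 / v 2] (h 1)) * h1

lemma exists_mem_forall_eval_sub_eq_zero {τ σ : Type*} (W : Submodule ℂ (MvPolynomial σ ℂ))
    (S : Finset τ) (pt : τ → σ → ℂ)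
    (h : ∀ s ∈ S, ∃ δ ∈ W, eval (pt s) δ ≠ 0 ∧ ∀ t ∈ S, t ≠ s → eval (pt t) δ = 0)
    (F : MvPolynomial σ ℂ) : ∃ G ∈ W, ∀ s ∈ S, eval (pt s) (F - G) = 0 := by
  classical
  choose! δ hW hne hz using h
  refine ⟨∑ s ∈ S, (eval (pt s) F / eval (pt s) (δ s)) • δ s,
    W.sum_mem fun s hs => W.smul_mem _ (hW s hs), fun s hs => ?_⟩
  rw [map_sub, map_sum, Finset.sum_eq_single_of_mem s hs, smul_eval, div_mul_cancel₀ _ (hne s hs),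
    sub_self]
  intro t ht hts
  rw [smul_eval, hz t ht s hs hts.symm, mul_zero]

/-- The tangent space to the variety of determinants at the matrix with diagonal `A, D` and
antidiagonal `B, E`. -/
noncomputable def detTangent (a b c e : ℕ) (A B D E : MvPolynomial (Fin 3) ℂ) :
    Submodule ℂ (MvPolynomial (Fin 3) ℂ) :=
  ((homogeneousSubmodule (Fin 3) ℂ b).map (LinearMap.mulLeft ℂ A) ⊔
    (homogeneousSubmodule (Fin 3) ℂ a).map (LinearMap.mulLeft ℂ D)) ⊔
  ((homogeneousSubmodule (Fin 3) ℂ e).map (LinearMap.mulLeft ℂ B) ⊔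
    (homogeneousSubmodule (Fin 3) ℂ c).map (LinearMap.mulLeft ℂ E))

lemma mem_detTangent {a b c e : ℕ} {A B D E F : MvPolynomial (Fin 3) ℂ} :
    F ∈ detTangent a b c e A B D E ↔ ∃ A' D' B' E' : MvPolynomial (Fin 3) ℂ,
      A'.IsHomogeneous a ∧ D'.IsHomogeneous b ∧ B'.IsHomogeneous c ∧ E'.IsHomogeneous e ∧
        F = A * D' + D * A' + (B * E' + E * B') := by
  simp only [detTangent, Submodule.mem_sup, Submodule.mem_map, LinearMap.mulLeft_apply,
    mem_homogeneousSubmodule]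
  constructor
  · rintro ⟨_, ⟨_, ⟨D', hD', rfl⟩, _, ⟨A', hA', rfl⟩, rfl⟩, _,
      ⟨_, ⟨E', hE', rfl⟩, _, ⟨B', hB', rfl⟩, rfl⟩, rfl⟩
    exact ⟨A', D', B', E', hA', hD', hB', hE', rfl⟩
  · rintro ⟨A', D', B', E', hA', hD', hB', hE', rfl⟩
    exact ⟨_, ⟨_, ⟨D', hD', rfl⟩, _, ⟨A', hA', rfl⟩, rfl⟩, _,
      ⟨_, ⟨E', hE', rfl⟩, _, ⟨B', hB', rfl⟩, rfl⟩, rfl⟩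

lemma exists_forall_mem_detTangent {a b c e d : ℕ} (hab : a + b = d) (hce : c + e = d) (he : 0 < e)
    (hea : e ≤ a) (heb : e ≤ b) :
    ∃ A D B E : MvPolynomial (Fin 3) ℂ, A.IsHomogeneous a ∧ D.IsHomogeneous b ∧
      B.IsHomogeneous c ∧ E.IsHomogeneous e ∧
      ∀ F : MvPolynomial (Fin 3) ℂ, F.IsHomogeneous d → F ∈ detTangent a b c e A B D E := by
  have hX : ∀ i : Fin 3, (X i : MvPolynomial (Fin 3) ℂ).IsHomogeneous 1 := isHomogeneous_X ℂ
  have hXX : (X 0 + X 1 : MvPolynomial (Fin 3) ℂ).IsHomogeneous 1 := (hX 0).add (hX 1)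
  let A := lineProd (X 0) (Finset.range a)
  let E := lineProd (X 1) (Finset.range e)
  let D := lineProd (X 0 + X 1) (Finset.range e) * X 2 ^ (b - e)
  let B := lineProd (X 0 + X 1) (Finset.Ico e (a + e - 1)) * X 2 ^ (c - (a - 1))
  have hA : A.IsHomogeneous a := by
    simpa [A] using lineProd_isHomogeneous (hX 0) (Finset.range a)
  have hE : E.IsHomogeneous e := by
    simpa [E] using lineProd_isHomogeneous (hX 1) (Finset.range e)
  have hD : D.IsHomogeneous b := by
    convert (lineProd_isHomogeneous hXX (Finset.range e)).mul
      (isHomogeneous_X_pow (2 : Fin 3) (b - e)) using 1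
    rw [Finset.card_range]; omega
  have hB : B.IsHomogeneous c := by
    convert (lineProd_isHomogeneous hXX (Finset.Ico e (a + e - 1))).mul
      (isHomogeneous_X_pow (2 : Fin 3) (c - (a - 1))) using 1
    rw [Nat.card_Ico]; omega
  refine ⟨A, D, B, E, hA, hD, hB, hE, fun F hF => ?_⟩
  have hW : ∀ G ∈ detTangent a b c e A B D E, G.IsHomogeneous d := by
    intro G hG
    obtain ⟨A', D', B', E', hA', hD', hB', hE', rfl⟩ := mem_detTangent.mp hG
    have h1 := (hA.mul hD').add (add_comm b a ▸ hD.mul hA')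
    have h2 := (hB.mul hE').add (add_comm e c ▸ hE.mul hB')
    rw [hab] at h1
    rw [hce] at h2
    exact h1.add h2
  have h0 : ∀ n, (0 : MvPolynomial (Fin 3) ℂ).IsHomogeneous n := isHomogeneous_zero _ _
  have hBmem : ∀ G : MvPolynomial (Fin 3) ℂ, G.IsHomogeneous e →
      B * G ∈ detTangent a b c e A B D E := fun G hG =>
    mem_detTangent.mpr ⟨0, 0, 0, G, h0 a, h0 b, h0 c, hG, by simp⟩
  have hDmem : ∀ G : MvPolynomial (Fin 3) ℂ, G.IsHomogeneous a →
      D * G ∈ detTangent a b c e A B D E := fun G hG =>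
    mem_detTangent.mpr ⟨G, 0, 0, 0, hG, h0 b, h0 c, h0 e, by simp⟩
  let pt : ℕ × ℕ → Fin 3 → ℂ := fun s => ![(s.1 : ℂ), s.2, 1]
  have hpt2 : ∀ s, pt s 2 = 1 := fun s => rfl
  have e0 : ∀ s, eval (pt s) (X 0) = s.1 := fun s => by simp [pt]
  have e1 : ∀ s, eval (pt s) (X 1) = s.2 := fun s => by simp [pt]
  have e2 : ∀ s, eval (pt s) (X 2) = 1 := fun s => by simp [pt]
  have e01 : ∀ s, eval (pt s) (X 0 + X 1) = ((s.1 + s.2 : ℕ) : ℂ) := fun s => by simp [pt]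
  have z0 : ∀ s T, eval (pt s) (lineProd (X 0) T) = 0 ↔ s.1 ∈ T := fun s _ =>
    eval_lineProd_eq_zero_iff (hpt2 s) (e0 s)
  have z1 : ∀ s T, eval (pt s) (lineProd (X 1) T) = 0 ↔ s.2 ∈ T := fun s _ =>
    eval_lineProd_eq_zero_iff (hpt2 s) (e1 s)
  have z01 : ∀ s T, eval (pt s) (lineProd (X 0 + X 1) T) = 0 ↔ s.1 + s.2 ∈ T := fun s _ =>
    eval_lineProd_eq_zero_iff (hpt2 s) (e01 s)
  have hδ : ∀ s ∈ Finset.range a ×ˢ Finset.range e, ∃ δ ∈ detTangent a b c e A B D E,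
      eval (pt s) δ ≠ 0 ∧ ∀ t ∈ Finset.range a ×ˢ Finset.range e, t ≠ s → eval (pt t) δ = 0 := by
    rintro ⟨p, q⟩ hs
    simp only [Finset.mem_product, Finset.mem_range] at hs
    by_cases hpq : p + q < e
    · refine ⟨B * (lineProd (X 0) (Finset.range p) * lineProd (X 1) (Finset.range q) *
        lineProd (X 0 + X 1) (Finset.Ioo (p + q) e) * X 2), hBmem _ ?_, ?_, ?_⟩
      · convert (((lineProd_isHomogeneous (hX 0) (Finset.range p)).mul
          (lineProd_isHomogeneous (hX 1) (Finset.range q))).mul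
          (lineProd_isHomogeneous hXX (Finset.Ioo (p + q) e))).mul (hX 2) using 1
        simp only [Finset.card_range, Nat.card_Ioo]; omega
      · simp only [B, map_mul, map_pow, e2, one_pow, mul_one, ne_eq, mul_eq_zero, z0, z1, z01,
          Finset.mem_range, Finset.mem_Ioo, Finset.mem_Ico]
        omega
      · rintro ⟨i, j⟩ ht hne
        simp only [Finset.mem_product, Finset.mem_range, ne_eq, Prod.mk.injEq] at ht hne
        simp only [B, map_mul, map_pow, e2, one_pow, mul_one, mul_eq_zero, z0, z1, z01,
          Finset.mem_range, Finset.mem_Ioo, Finset.mem_Ico]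
        omega
    · refine ⟨D * (lineProd (X 0) (Finset.Ioo p a) * lineProd (X 1) (Finset.Ioo q e) *
        lineProd (X 0 + X 1) (Finset.Ico e (p + q)) * X 2 ^ 2), hDmem _ ?_, ?_, ?_⟩
      · convert (((lineProd_isHomogeneous (hX 0) (Finset.Ioo p a)).mul
          (lineProd_isHomogeneous (hX 1) (Finset.Ioo q e))).mul
          (lineProd_isHomogeneous hXX (Finset.Ico e (p + q)))).mul
            (isHomogeneous_X_pow (2 : Fin 3) 2) using 1
        simp only [Nat.card_Ioo, Nat.card_Ico]; omega
      · simp only [D, map_mul, map_pow, e2, one_pow, mul_one, ne_eq, mul_eq_zero, z0, z1, z01,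
          Finset.mem_range, Finset.mem_Ioo, Finset.mem_Ico]
        omega
      · rintro ⟨i, j⟩ ht hne
        simp only [Finset.mem_product, Finset.mem_range, ne_eq, Prod.mk.injEq] at ht hne
        simp only [D, map_mul, map_pow, e2, one_pow, mul_one, mul_eq_zero, z0, z1, z01,
          Finset.mem_range, Finset.mem_Ioo, Finset.mem_Ico]
        omega
  obtain ⟨G, hG, hFG⟩ := exists_mem_forall_eval_sub_eq_zero _ _ pt hδ F
  obtain ⟨U, V, hU, hV, hUV⟩ := exists_eq_add_of_forall_eval_grid_eq_zero (he.trans_le hea) he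
    (by omega) (by omega) (hF.sub (hW G hG)) fun i hi j hj =>
      hFG (i, j) (Finset.mem_product.mpr ⟨Finset.mem_range.mpr hi, Finset.mem_range.mpr hj⟩)
  rw [← sub_add_cancel F G]
  refine Submodule.add_mem _ (mem_detTangent.mpr ⟨0, U, V, 0, h0 a, ?_, ?_, h0 e, ?_⟩) hG
  · rwa [show d - a = b by omega] at hU
  · rwa [show d - e = c by omega] at hV
  · rw [hUV]; simp [A, E]

lemma isFormOfDeg_natCast {k n : ℕ} {f : MvPolynomial (Fin k) ℂ} :
    IsFormOfDeg f (n : ℤ) ↔ f.IsHomogeneous n := by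
  simp [IsFormOfDeg]

lemma generalForm_natCast_iff {n : ℕ} {P : MvPolynomial (Fin 3) ℂ → Prop} :
    GeneralForm 3 n P ↔ ∃ Ψ : MvPolynomial (TernaryExponent n) ℂ, Ψ ≠ 0 ∧
      ∀ F : MvPolynomial (Fin 3) ℂ, F.IsHomogeneous n → eval (fun m => coeff m.1 F) Ψ ≠ 0 → P F := by
  classical
  constructor
  · rintro ⟨Φ, ⟨f, hf, hfΦ⟩, h⟩
    let Ψ : MvPolynomial (TernaryExponent n) ℂ :=
      aeval (fun m => if hm : m.degree = n then X ⟨m, hm⟩ else 0) Φ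
    have heval : ∀ F : MvPolynomial (Fin 3) ℂ, F.IsHomogeneous n →
        eval (fun m => coeff m.1 F) Ψ = eval F.coeff Φ := by
      intro F hF
      rw [← aeval_eq_eval, ← AlgHom.comp_apply, comp_aeval, ← aeval_eq_eval]
      congr 2
      ext m
      by_cases hm : m.degree = n
      · simp [hm]
      · simp [hm, hF.coeff_eq_zero_of_degree_ne hm]
    refine ⟨Ψ, fun h0 => hfΦ ?_, fun F hF hFΨ => h F (isFormOfDeg_natCast.mpr hF) ?_⟩
    · rw [← heval f (isFormOfDeg_natCast.mp hf), h0, map_zero]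
    · rwa [← heval F hF]
  · rintro ⟨Ψ, hΨ, h⟩
    have heval : ∀ F : MvPolynomial (Fin 3) ℂ,
        eval F.coeff (rename Subtype.val Ψ) = eval (fun m => coeff m.1 F) Ψ := fun F => by
      rw [eval_rename]; rfl
    refine ⟨rename Subtype.val Ψ, ?_, fun F hF hFΨ => h F (isFormOfDeg_natCast.mp hF) ?_⟩
    · obtain ⟨x, hx⟩ : ∃ x, eval x Ψ ≠ 0 := by
        by_contra! hh
        exact hΨ (funext fun x => by simpa using hh x)
      refine ⟨ternaryForm n x, isFormOfDeg_natCast.mpr (ternaryForm_isHomogeneous x), ?_⟩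
      rw [heval]
      simpa only [coeff_ternaryForm] using hx
    · rwa [← heval]

lemma isFormOfDeg_zero {k : ℕ} (m : ℤ) : IsFormOfDeg (0 : MvPolynomial (Fin k) ℂ) m := by
  unfold IsFormOfDeg
  split_ifs
  exacts [rfl, isHomogeneous_zero _ _ _]

lemma generalForm_of_forall {d : ℤ} {P : MvPolynomial (Fin 3) ℂ → Prop}
    (h : ∀ F, IsFormOfDeg F d → P F) : GeneralForm 3 d P :=
  ⟨1, ⟨0, isFormOfDeg_zero d, by simp⟩, fun F hF _ => h F hF⟩

/-- The exponent of the monomial `X i ^ n`. -/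
noncomputable def TernaryExponent.pure (i : Fin 3) (n : ℕ) : TernaryExponent n :=
  ⟨Finsupp.single i n, Finsupp.degree_single i n⟩

lemma TernaryExponent.sum_eq {n : ℕ} (u : TernaryExponent n) : u.1 0 + u.1 1 + u.1 2 = n := by
  have := u.2
  rwa [Finsupp.degree_eq_sum, Fin.sum_univ_three] at this

lemma coeff_pure_ne_zero_of_mul {a b : ℕ} {A D : MvPolynomial (Fin 3) ℂ} (hA : A.IsHomogeneous a)
    (h : coeff (TernaryExponent.pure 0 (a + b)).1 (A * D) ≠ 0) :
    coeff (TernaryExponent.pure 0 a).1 A ≠ 0 := by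
  intro h0
  rw [coeff_mul] at h
  refine h (Finset.sum_eq_zero ?_)
  rintro ⟨u, v⟩ huv
  rw [Finset.HasAntidiagonal.mem_antidiagonal] at huv
  by_cases hu : u.degree = a
  · have h1 := DFunLike.congr_fun huv 1
    have h2 := DFunLike.congr_fun huv 2
    have h3 := TernaryExponent.sum_eq ⟨u, hu⟩
    simp [TernaryExponent.pure] at h1 h2 h3
    have : u = (TernaryExponent.pure 0 a).1 := by
      ext i
      fin_cases i <;> simp [TernaryExponent.pure] <;> omega
    rw [this, h0, zero_mul]
  · rw [hA.coeff_eq_zero_of_degree_ne hu, zero_mul]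

lemma card_pureless_sum_lt {a b : ℕ} (ha : 0 < a) (hb : 0 < b) :
    Nat.card ({u : TernaryExponent a // u ≠ .pure 0 a} ⊕ TernaryExponent b) <
      Nat.card (TernaryExponent (a + b)) := by
  have := Fintype.ofFinite ({u : TernaryExponent a // u ≠ .pure 0 a} ⊕ TernaryExponent b)
  rw [Nat.card_eq_fintype_card, Nat.card_eq_fintype_card]
  let f : {u : TernaryExponent a // u ≠ .pure 0 a} ⊕ TernaryExponent b → TernaryExponent (a + b) :=
    Sum.elim (fun u => ⟨u.1.1 + Finsupp.single 1 b, by rw [map_add, u.1.2, Finsupp.degree_single]⟩)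
      (fun v => ⟨Finsupp.single 0 a + v.1, by rw [map_add, v.2, Finsupp.degree_single]⟩)
  refine Fintype.card_lt_of_injective_of_notMem f (b := .pure 2 (a + b)) ?_ ?_
  · have key : ∀ (u : {u : TernaryExponent a // u ≠ .pure 0 a}) (v : TernaryExponent b),
        u.1.1 + Finsupp.single 1 b ≠ Finsupp.single 0 a + v.1 := by
      intro u v h
      refine u.2 (Subtype.ext ?_)
      have h0 := DFunLike.congr_fun h 0
      have h3 := u.1.sum_eq
      simp at h0
      ext i
      fin_cases i <;> simp [TernaryExponent.pure] <;> omega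
    rintro (u | u) (v | v) h
    · exact congrArg Sum.inl (Subtype.ext (Subtype.ext (add_right_cancel (congrArg Subtype.val h))))
    · exact (key u v (congrArg Subtype.val h)).elim
    · exact (key v u (congrArg Subtype.val h).symm).elim
    · exact congrArg Sum.inr (Subtype.ext (add_left_cancel (congrArg Subtype.val h)))
  · rintro ⟨u | u, hu⟩
    · have h1 : u.1.1 1 + Finsupp.single (1 : Fin 3) b 1 = Finsupp.single (2 : Fin 3) (a + b) 1 :=
        DFunLike.congr_fun (congrArg Subtype.val hu) 1
      simp at h1
      omega
    · have h0 : Finsupp.single (0 : Fin 3) a 0 + u.1 0 = Finsupp.single (2 : Fin 3) (a + b) 0 :=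
        DFunLike.congr_fun (congrArg Subtype.val hu) 0
      simp at h0
      omega

lemma not_generalForm_eq_mul {a b : ℕ} (ha : 0 < a) (hb : 0 < b) :
    ¬ GeneralForm 3 ((a + b : ℕ) : ℤ) fun F => ∃ A D : MvPolynomial (Fin 3) ℂ,
      A.IsHomogeneous a ∧ D.IsHomogeneous b ∧ F = A * D := by
  classical
  rw [generalForm_natCast_iff]
  rintro ⟨Ψ, hΨ, h⟩
  let P := {u : TernaryExponent a // u ≠ .pure 0 a} ⊕ TernaryExponent b
  let g : TernaryExponent (a + b) → MvPolynomial P ℂ := fun m => coeff m.1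
    (ternaryForm a (fun u => if hu : u = .pure 0 a then 1 else
        (X (.inl ⟨u, hu⟩) : MvPolynomial P ℂ)) *
      ternaryForm b (fun v => (X (.inr v) : MvPolynomial P ℂ)))
  refine (card_pureless_sum_lt ha hb).not_ge (card_le_card_of_open_subset_range g
    (Ψ * X (.pure 0 (a + b))) (mul_ne_zero hΨ (X_ne_zero _)) fun x hx => ?_)
  rw [map_mul, eval_X] at hx
  obtain ⟨A, D, hA, hD, hAD⟩ := h (ternaryForm _ x) (ternaryForm_isHomogeneous x)
    (by simpa only [coeff_ternaryForm] using left_ne_zero_of_mul hx)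
  have hα : coeff (TernaryExponent.pure 0 a).1 A ≠ 0 := by
    refine coeff_pure_ne_zero_of_mul (b := b) (D := D) hA ?_
    rw [← hAD, coeff_ternaryForm]
    exact right_ne_zero_of_mul hx
  set α := coeff (TernaryExponent.pure 0 a).1 A with hα_def
  refine ⟨Sum.elim (fun u => α⁻¹ * coeff u.1.1 A) (fun v => α * coeff v.1 D), fun m => ?_⟩
  rw [← coeff_ternaryForm x m, hAD]
  simp only [g, ← coeff_map, map_mul, map_ternaryForm]
  congr 1
  have h1 : ∀ u : TernaryExponent a, eval (Sum.elim (fun u => α⁻¹ * coeff u.1.1 A)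
      (fun v => α * coeff v.1 D)) (if hu : u = .pure 0 a then 1 else
        (X (.inl ⟨u, hu⟩) : MvPolynomial P ℂ)) = (α⁻¹ • fun u : TernaryExponent a => coeff u.1 A) u := by
    intro u
    by_cases hu : u = .pure 0 a
    · simp [hu, ← hα_def, hα]
    · simp [hu]
  have h2 : ∀ v : TernaryExponent b, eval (Sum.elim (fun u => α⁻¹ * coeff u.1.1 A)
      (fun v => α * coeff v.1 D)) (X (.inr v) : MvPolynomial P ℂ) =
        (α • fun v : TernaryExponent b => coeff v.1 D) v := by
    intro v
    simp
  simp only [Function.comp_def, h1, h2]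
  change ternaryForm a (α⁻¹ • fun u : TernaryExponent a => coeff u.1 A) *
    ternaryForm b (α • fun v : TernaryExponent b => coeff v.1 D) = _
  rw [map_smul, map_smul, ternaryForm_coeff hA, ternaryForm_coeff hD, smul_mul_smul_comm,
    inv_mul_cancel₀ hα, one_smul]

lemma not_generalForm_eq_zero (d : ℕ) : ¬ GeneralForm 3 (d : ℤ) fun F => F = 0 := by
  rw [generalForm_natCast_iff]
  rintro ⟨Ψ, hΨ, h⟩
  have := card_le_card_of_open_subset_range (P := Empty) (fun _ => 0) Ψ hΨ fun x hx => by
    have h0 := h (ternaryForm d x) (ternaryForm_isHomogeneous x)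
      (by simpa only [coeff_ternaryForm] using hx)
    exact ⟨0, fun m => by rw [← coeff_ternaryForm x m, h0, coeff_zero, map_zero]⟩
  have : Nonempty (TernaryExponent d) := ⟨.pure 0 d⟩
  have := Nat.card_pos (α := TernaryExponent d)
  simp_all

lemma GeneralForm.mono {k : ℕ} {d : ℤ} {P Q : MvPolynomial (Fin k) ℂ → Prop}
    (h : GeneralForm k d P) (hPQ : ∀ F, P F → Q F) : GeneralForm k d Q := by
  obtain ⟨Φ, hΦ, hP⟩ := h
  exact ⟨Φ, hΦ, fun F hF hFΦ => hPQ F (hP F hF hFΦ)⟩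

lemma hasDegMatrix_fin_two {k : ℕ} {M : Matrix (Fin 2) (Fin 2) ℤ}
    {A B E D : MvPolynomial (Fin k) ℂ} (hA : IsFormOfDeg A (M 0 0)) (hB : IsFormOfDeg B (M 0 1))
    (hE : IsFormOfDeg E (M 1 0)) (hD : IsFormOfDeg D (M 1 1)) :
    HasDegMatrix !![A, B; E, D] M := by
  intro i j
  fin_cases i <;> fin_cases j
  exacts [hA, hB, hE, hD]

lemma isFormOfDeg_one {k : ℕ} : IsFormOfDeg (1 : MvPolynomial (Fin k) ℂ) 0 := by
  simpa [IsFormOfDeg] using isHomogeneous_one (Fin k) ℂ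

/-- (Theorem 3.5, the `2×2` case.)  For a homogeneous well-ordered `2×2` integer matrix `M`
of degree `d > 0`, a general form of degree `d` in `ℂ[x₀,x₁,x₂]` is the determinant of a
matrix of forms with degree matrix `M` iff `m₁₁ = 0`, or `m₁₁ = d`, or `m₂₁ ≥ 0`. -/
theorem stmt_4 (M : Matrix (Fin 2) (Fin 2) ℤ)
    (hM : IsHomogMatrix M) (hMw : WellOrderedMatrix M)
    (d : ℤ) (hd : d = M 0 0 + M 1 1) (hd0 : 0 < d) :
    GeneralForm 3 d (fun F => ∃ N : Matrix (Fin 2) (Fin 2) (MvPolynomial (Fin 3) ℂ),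
        HasDegMatrix N M ∧ N.det = F) ↔
      (M 0 0 = 0 ∨ M 0 0 = d ∨ 0 ≤ M 1 0) := by
  have hsum : M 0 0 + M 1 1 = M 0 1 + M 1 0 := hM 0 1 0 1 (by decide) (by decide)
  constructor
  · intro h
    by_contra! hne
    obtain ⟨h0, hdne, hneg⟩ := hne
    have hN10 : ∀ N : Matrix (Fin 2) (Fin 2) (MvPolynomial (Fin 3) ℂ), HasDegMatrix N M →
        N.det = N 0 0 * N 1 1 := fun N hN => by
      have := hN 1 0
      rw [IsFormOfDeg, if_pos hneg] at this
      rw [det_fin_two, this, mul_zero, sub_zero]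
    by_cases hpos : 0 < M 0 0 ∧ 0 < M 1 1
    · obtain ⟨a, ha⟩ := Int.eq_ofNat_of_zero_le hpos.1.le
      obtain ⟨b, hb⟩ := Int.eq_ofNat_of_zero_le hpos.2.le
      rw [hd, ha, hb, ← Nat.cast_add] at h
      refine not_generalForm_eq_mul (a := a) (b := b) (by omega) (by omega) (h.mono ?_)
      rintro F ⟨N, hN, rfl⟩
      exact ⟨N 0 0, N 1 1, isFormOfDeg_natCast.mp (ha ▸ hN 0 0),
        isFormOfDeg_natCast.mp (hb ▸ hN 1 1), hN10 N hN⟩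
    · obtain ⟨n, rfl⟩ := Int.eq_ofNat_of_zero_le hd0.le
      refine not_generalForm_eq_zero n (h.mono ?_)
      rintro F ⟨N, hN, rfl⟩
      rw [hN10 N hN]
      have h00 := hN 0 0
      have h11 := hN 1 1
      unfold IsFormOfDeg at h00 h11
      by_cases h1 : M 0 0 < 0
      · rw [if_pos h1] at h00
        rw [h00, zero_mul]
      · rw [if_pos (by omega)] at h11
        rw [h11, mul_zero]
  · rintro (h | h | h)
    · refine generalForm_of_forall fun F hF => ⟨!![1, 0; 0, F], hasDegMatrix_fin_two
        (h ▸ isFormOfDeg_one) (isFormOfDeg_zero _) (isFormOfDeg_zero _) ?_, by simp⟩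
      rwa [show M 1 1 = d by omega]
    · refine generalForm_of_forall fun F hF => ⟨!![F, 0; 0, 1], hasDegMatrix_fin_two
        (h ▸ hF) (isFormOfDeg_zero _) (isFormOfDeg_zero _) ?_, by simp⟩
      rw [show M 1 1 = 0 by omega]
      exact isFormOfDeg_one
    · by_cases he0 : M 1 0 = 0
      · refine generalForm_of_forall fun F hF => ⟨!![0, F; -1, 0], hasDegMatrix_fin_two
          (isFormOfDeg_zero _) ?_ ?_ (isFormOfDeg_zero _), by simp⟩
        · rwa [show M 0 1 = d by omega]
        · rw [he0]
          simpa [IsFormOfDeg] using (isHomogeneous_one (Fin 3) ℂ).neg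
      have hea : M 1 0 ≤ M 0 0 := hMw.1 0 1 0 (by decide)
      have heb : M 1 0 ≤ M 1 1 := hMw.2 1 0 1 (by decide)
      have hac : M 0 0 ≤ M 0 1 := hMw.2 0 0 1 (by decide)
      obtain ⟨e, he⟩ := Int.eq_ofNat_of_zero_le h
      obtain ⟨a, ha⟩ := Int.eq_ofNat_of_zero_le (h.trans hea)
      obtain ⟨b, hb⟩ := Int.eq_ofNat_of_zero_le (h.trans heb)
      obtain ⟨c, hc⟩ := Int.eq_ofNat_of_zero_le ((h.trans hea).trans hac)
      obtain ⟨n, rfl⟩ := Int.eq_ofNat_of_zero_le hd0.le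
      have hab : a + b = n := by omega
      have hce : c + e = n := by omega
      obtain ⟨A, D, B, E, hA, hD, hB, hE, hspan⟩ :=
        exists_forall_mem_detTangent hab hce (by omega) (by omega) (by omega)
      obtain ⟨Φ, hΦ, hdet⟩ := exists_dominant_det hab hce hA hD hB hE fun F hF => by
        obtain ⟨A', D', B', E', hA', hD', hB', hE', rfl⟩ := mem_detTangent.mp (hspan F hF)
        exact ⟨A', D', -B', -E', hA', hD', hB'.neg, hE'.neg, by ring⟩
      refine generalForm_natCast_iff.mpr ⟨Φ, hΦ, fun F hF hFΦ => ?_⟩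
      obtain ⟨A', D', B', E', hA', hD', hB', hE', rfl⟩ := hdet F hF hFΦ
      refine ⟨!![A', B'; E', D'], hasDegMatrix_fin_two ?_ ?_ ?_ ?_, by simp [det_fin_two]⟩
      · rwa [ha, isFormOfDeg_natCast]
      · rwa [hc, isFormOfDeg_natCast]
      · rwa [he, isFormOfDeg_natCast]
      · rwa [hb, isFormOfDeg_natCast]
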